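/- arXiv:0901.1743 — 2 statements merged into one kernel-verified Lean document; each statement's English description precedes it below -/
import Mathlib

section
/- If d is odd, then every operator of the regular representation has order dividing d: Π(I)^d = 1 for all I ∈ G; in particular every eigenvalue of Π(I) is a d-th root of unity. -/
open scoped BigOperators InnerProductSpace
open Filter Topology Finset

noncomputable section

/-- The symplectic form `σ(k,l) = k₁l₂ − k₂l₁` on `R × R`. -/
def symp {R : Type*} [CommRing R] (k l : R × R) : R := k.1 * l.2 - k.2 * l.1

/-- Matrix–vector product of a `2 × 2` matrix with a pair. -/
def mvec {R : Type*} [CommRing R] (A : Matrix (Fin 2) (Fin 2) R) (k : R × R) : R × R :=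
  (A 0 0 * k.1 + A 0 1 * k.2, A 1 0 * k.1 + A 1 1 * k.2)

/-- The consistency condition `σ(k, A(−n)·l) = −σ(l, A(n)·k)` on the defining matrices. -/
def Consistent (d : ℕ) (A : ℤ → Matrix (Fin 2) (Fin 2) (ZMod d)) : Prop :=
  ∀ (n : ℤ) (k l : ZMod d × ZMod d),
    symp k (mvec (A (-n)) l) = - symp l (mvec (A n) k)

/-- `c(I,J) = Σ_{a>b} σ(I(a), A(b−a)·J(b)) + Σ_a (I(a))₁·(J(a))₂ ∈ ZMod d`. -/
def cExp (d : ℕ) (A : ℤ → Matrix (Fin 2) (Fin 2) (ZMod d))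
    (I J : ℤ →₀ (ZMod d × ZMod d)) : ZMod d :=
  (∑ a ∈ I.support, ∑ b ∈ J.support,
      if b < a then symp (I a) (mvec (A (b - a)) (J b)) else 0)
    + ∑ a ∈ I.support, (I a).1 * (J a).2

/-- The multiplier `ω(I,J) = exp(2πi·c(I,J)/d)` (using the representative `(c(I,J)).val`). -/
def omegaMul (d : ℕ) (A : ℤ → Matrix (Fin 2) (Fin 2) (ZMod d))
    (I J : ℤ →₀ (ZMod d × ZMod d)) : ℂ :=
  Complex.exp (2 * Real.pi * Complex.I * ((cExp d A I J).val : ℂ) / d)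

/-- The commutation exponent `B(I,J) = Σ_{a,b} σ(I(a), A(b−a)·J(b)) ∈ ZMod d`. -/
def Bexp (d : ℕ) (A : ℤ → Matrix (Fin 2) (Fin 2) (ZMod d))
    (I J : ℤ →₀ (ZMod d × ZMod d)) : ZMod d :=
  ∑ a ∈ I.support, ∑ b ∈ J.support, symp (I a) (mvec (A (b - a)) (J b))

/-- The Hilbert space `ℓ²(G)` over the group `G` of finitely supported functions
`ℤ → (ZMod d)²`. -/
abbrev HS (d : ℕ) := lp (fun _ : ℤ →₀ (ZMod d × ZMod d) => ℂ) 2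

/-- The standard orthonormal basis vector `e_J` of `ℓ²(G)`. -/
def eVec (d : ℕ) (J : ℤ →₀ (ZMod d × ZMod d)) : HS d := lp.single 2 J 1

/-- The shift on `G`: `(S I)(n) = I(n − 1)`. -/
def Sg {d : ℕ} (I : ℤ →₀ (ZMod d × ZMod d)) : ℤ →₀ (ZMod d × ZMod d) :=
  Finsupp.equivMapDomain (Equiv.addRight (1 : ℤ)) I

lemma cExp_add (d : ℕ) (A : ℤ → Matrix (Fin 2) (Fin 2) (ZMod d))
    (I J K : ℤ →₀ (ZMod d × ZMod d)) :
    cExp d A I (J + K) = cExp d A I J + cExp d A I K := by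
  have h : ∀ L : ℤ →₀ (ZMod d × ZMod d), cExp d A I L =
      ∑ a ∈ I.support, ((L.sum fun b v => if b < a then symp (I a) (mvec (A (b - a)) v) else 0)
        + (I a).1 * (L a).2) := by
    intro L
    rw [Finset.sum_add_distrib]
    rfl
  rw [h, h, h, ← Finset.sum_add_distrib]
  refine Finset.sum_congr rfl fun a _ => ?_
  rw [Finsupp.sum_add_index']
  · simp only [Finsupp.add_apply, Prod.snd_add]
    ring
  · intro b
    simp [symp, mvec]
  · intro b v w
    split_ifs
    · simp only [symp, mvec, Prod.fst_add, Prod.snd_add]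
      ring
    · simp

lemma cExp_nsmul (d : ℕ) (A : ℤ → Matrix (Fin 2) (Fin 2) (ZMod d))
    (I J K : ℤ →₀ (ZMod d × ZMod d)) (n : ℕ) :
    cExp d A I (n • K + J) = n * cExp d A I K + cExp d A I J := by
  induction n with
  | zero => simp
  | succ n ih =>
    rw [succ_nsmul', add_assoc, cExp_add, ih]
    push_cast
    ring

lemma omegaMul_eq (d : ℕ) [NeZero d] (A : ℤ → Matrix (Fin 2) (Fin 2) (ZMod d))
    (I J : ℤ →₀ (ZMod d × ZMod d)) :
    omegaMul d A I J = ZMod.stdAddChar (cExp d A I J) := by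
  rw [ZMod.stdAddChar_apply, ZMod.toCircle_apply, omegaMul]

lemma rep_pow (d : ℕ) [NeZero d] (A : ℤ → Matrix (Fin 2) (Fin 2) (ZMod d))
    (rep : (ℤ →₀ (ZMod d × ZMod d)) → (HS d →L[ℂ] HS d))
    (hrep : ∀ I J, rep I (eVec d J) = omegaMul d A I J • eVec d (I + J))
    (I J : ℤ →₀ (ZMod d × ZMod d)) (n : ℕ) :
    (rep I ^ n) (eVec d J) =
      (ZMod.stdAddChar ((n : ZMod d) * cExp d A I J + ((n.choose 2 : ℕ) : ZMod d) * cExp d A I I) : ℂ) •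
        eVec d (n • I + J) := by
  induction n with
  | zero => simp
  | succ n ih =>
    rw [pow_succ', ContinuousLinearMap.mul_apply, ih, map_smul, hrep, smul_smul, omegaMul_eq,
      cExp_nsmul, ← AddChar.map_add_eq_mul, succ_nsmul', add_assoc I]
    congr 2
    rw [Nat.choose_succ_succ' n 1, Nat.choose_one_right]
    push_cast
    ring

theorem stmt4 (d : ℕ) (hd : 3 ≤ d) (hodd : Odd d)
    (A : ℤ → Matrix (Fin 2) (Fin 2) (ZMod d)) (hA0 : A 0 = 1) (hA : Consistent d A)
    (rep : (ℤ →₀ (ZMod d × ZMod d)) → (HS d →L[ℂ] HS d))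
    (hrep : ∀ I J, rep I (eVec d J) = omegaMul d A I J • eVec d (I + J)) :
    ∀ I, rep I ^ d = 1 ∧
      ∀ μ : ℂ, Module.End.HasEigenvalue ((rep I).toLinearMap) μ → μ ^ d = 1 := by
  intro I
  have : NeZero d := ⟨by omega⟩
  have hbasis : ∀ J, (rep I ^ d) (eVec d J) = eVec d J := by
    intro J
    have h1 : ((d.choose 2 : ℕ) : ZMod d) = 0 := by
      rw [ZMod.natCast_eq_zero_iff, Nat.choose_two_right]
      obtain ⟨k, rfl⟩ := hodd
      refine ⟨k, ?_⟩
      rw [Nat.add_sub_cancel, mul_left_comm, Nat.mul_div_cancel_left _ (by norm_num)]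
    have h2 : d • I = 0 := by
      ext a <;> simp
    rw [rep_pow d A rep hrep, h1, h2]
    simp
  have hpow : rep I ^ d = 1 := by
    refine lp.ext_continuousLinearMap (by norm_num) fun J => ?_
    refine ContinuousLinearMap.ext_ring ?_
    exact hbasis J
  refine ⟨hpow, fun μ hμ => ?_⟩
  obtain ⟨v, hv⟩ := hμ.exists_hasEigenvector
  have h3 := hv.pow_apply d
  have h4 : ((rep I).toLinearMap ^ d) v = (rep I ^ d) v := by
    rw [← ContinuousLinearMap.coe_pow]
    rfl
  rw [h4, hpow, ContinuousLinearMap.one_apply] at h3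
  have h5 : (μ ^ d - 1) • v = 0 := by
    rw [sub_smul, ← h3, one_smul, sub_self]
  rcases smul_eq_zero.mp h5 with h | h
  · exact sub_eq_zero.mp h
  · exact absurd h hv.2
end
end

section
/- (Lemma 3) For I ∈ G and n ∈ ℕ set v_n(I) := exp(2πi·m_n/d) where m_n ∈ ℤ represents u_n(I) := B(I, Sⁿ I) ∈ ZMod d. Assume that for every I ≠ 0 and every μ ∈ [0,1) the limit ν_μ(I) := lim_{N→∞} (1/N) Σ_{n=0}^{N−1} v_n(I)·exp(−2πi·n·μ) exists, that ν_μ(I) = 0 for every μ ∈ (0,1), and that ν₀(I) ≠ 1. Then the vector state is tracial: ⟨Ω, π(I)Ω⟩ = 0 for every I ≠ 0, and ⟨Ω, π(I)(π(J)Ω)⟩ = ⟨Ω, π(J)(π(I)Ω)⟩ for all I, J ∈ G. -/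
open scoped BigOperators InnerProductSpace
open Filter Topology Finset

noncomputable section

theorem spec_measure {H : Type*} [NormedAddCommGroup H] [InnerProductSpace ℂ H] [CompleteSpace H]
    (T : H →L[ℂ] H) (hT : IsStarNormal T) (x : H) :
    ∃ m : MeasureTheory.Measure (spectrum ℂ T), MeasureTheory.IsFiniteMeasure m ∧
      ∀ n : ℕ, ⟪x, (T ^ n) x⟫_ℂ = ∫ z, ((z : ℂ)) ^ n ∂m := by
  let Φ : C(spectrum ℂ T, ℂ) →⋆ₐ[ℂ] (H →L[ℂ] H) := cfcHom hT
  let R : C(spectrum ℂ T, ℝ) → C(spectrum ℂ T, ℂ) := fun f => ⟨fun z => (f z : ℂ), by fun_prop⟩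
  have hRadd : ∀ f g, R (f + g) = R f + R g := by
    intro f g; ext z; simp [R]
  have hRsmul : ∀ (c : ℝ) f, R (c • f) = (c : ℂ) • R f := by
    intro f g; ext z; simp [R]
  have hRstar : ∀ f, star (R f) = R f := by
    intro f; ext z; simp [R]
  have hRself : ∀ f u w, ⟪u, Φ (R f) w⟫_ℂ = ⟪Φ (R f) u, w⟫_ℂ := by
    intro f u w
    have h : star (Φ (R f)) = Φ (R f) := by rw [← map_star, hRstar]
    conv_lhs => rw [← h]
    rw [ContinuousLinearMap.star_eq_adjoint, ContinuousLinearMap.adjoint_inner_right]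
  have hreal : ∀ f, ⟪x, Φ (R f) x⟫_ℂ = ((⟪x, Φ (R f) x⟫_ℂ).re : ℂ) := by
    intro f
    symm
    apply Complex.conj_eq_iff_re.mp
    rw [inner_conj_symm, hRself]
  have hpos : ∀ f : C(spectrum ℂ T, ℝ), (∀ z, 0 ≤ f z) → 0 ≤ (⟪x, Φ (R f) x⟫_ℂ).re := by
    intro f hf
    let s : C(spectrum ℂ T, ℝ) := ⟨fun z => Real.sqrt (f z), by fun_prop⟩
    have hs : R f = R s * R s := by
      ext z
      simp only [R, s, ContinuousMap.coe_mk, ContinuousMap.mul_apply]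
      rw [← Complex.ofReal_mul, Real.mul_self_sqrt (hf z)]
    rw [hs, map_mul]
    change 0 ≤ (⟪x, Φ (R s) (Φ (R s) x)⟫_ℂ).re
    rw [hRself]
    exact inner_self_nonneg (𝕜 := ℂ)
  let Λ : CompactlySupportedContinuousMap (spectrum ℂ T) ℝ →ₚ[ℝ] ℝ :=
    { toFun := fun g => (⟪x, Φ (R g) x⟫_ℂ).re
      map_add' := by
        intro g g'
        have : R ((g + g' : CompactlySupportedContinuousMap (spectrum ℂ T) ℝ) : C(spectrum ℂ T, ℝ))
          = R (g : C(spectrum ℂ T, ℝ)) + R (g' : C(spectrum ℂ T, ℝ)) := by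
          ext z; simp [R]
        simp only [this]
        simp [inner_add_right]
      map_smul' := by
        intro c g
        have : R ((c • g : CompactlySupportedContinuousMap (spectrum ℂ T) ℝ) : C(spectrum ℂ T, ℝ))
          = (c : ℂ) • R (g : C(spectrum ℂ T, ℝ)) := by
          ext z; simp [R]
        simp only [this]
        simp [inner_smul_right]
      monotone' := by
        intro g g' h
        have h2 := hpos ((g' : C(spectrum ℂ T, ℝ)) - (g : C(spectrum ℂ T, ℝ)))
          (fun z => by simpa using h z)
        have : R ((g' : C(spectrum ℂ T, ℝ)) - (g : C(spectrum ℂ T, ℝ)))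
          = R (g' : C(spectrum ℂ T, ℝ)) - R (g : C(spectrum ℂ T, ℝ)) := by
          ext z; simp [R]
        rw [this, map_sub, ContinuousLinearMap.sub_apply, inner_sub_right, Complex.sub_re] at h2
        exact sub_nonneg.mp h2 }
  have hfin : MeasureTheory.IsFiniteMeasure (RealRMK.rieszMeasure Λ) := by infer_instance
  refine ⟨RealRMK.rieszMeasure Λ, hfin, fun n => ?_⟩
  have key : ∀ f : C(spectrum ℂ T, ℝ),
      ((∫ z, f z ∂(RealRMK.rieszMeasure Λ) : ℝ) : ℂ) = ⟪x, Φ (R f) x⟫_ℂ := by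
    intro f
    rw [hreal]
    congr 1
    exact RealRMK.integral_rieszMeasure Λ (CompactlySupportedContinuousMap.continuousMapEquiv f)
  let F : C(spectrum ℂ T, ℂ) := ((ContinuousMap.id ℂ).restrict (spectrum ℂ T)) ^ n
  have hF : Φ F = T ^ n := by
    simp only [F, map_pow]
    congr 1
    exact cfcHom_id hT
  let fr : C(spectrum ℂ T, ℝ) := ⟨fun z => (F z).re, by fun_prop⟩
  let fi : C(spectrum ℂ T, ℝ) := ⟨fun z => (F z).im, by fun_prop⟩
  have hFd : F = R fr + Complex.I • R fi := by
    ext z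
    simp only [R, fr, fi, ContinuousMap.add_apply, ContinuousMap.smul_apply, ContinuousMap.coe_mk,
      smul_eq_mul]
    rw [mul_comm, Complex.re_add_im]
  have hint : MeasureTheory.Integrable (fun z => F z) (RealRMK.rieszMeasure Λ) :=
    F.continuous.integrable_of_hasCompactSupport (HasCompactSupport.of_compactSpace _)
  have e1 : ∫ z, ((z : ℂ)) ^ n ∂(RealRMK.rieszMeasure Λ) = ∫ z, F z ∂(RealRMK.rieszMeasure Λ) := by
    congr 1
  rw [e1, ← hF]
  conv_lhs => rw [hFd]
  rw [map_add, map_smul, ContinuousLinearMap.add_apply, ContinuousLinearMap.smul_apply,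
    inner_add_right, inner_smul_right, ← key, ← key, ← integral_re_add_im hint]
  simp [fr, fi, mul_comm]

theorem avg_spec {H : Type*} [NormedAddCommGroup H] [InnerProductSpace ℂ H] [CompleteSpace H]
    (U : H ≃ₗᵢ[ℂ] H) (x : H) :
    ∃ p : ℝ, 0 ≤ p ∧ ∀ (v : ℕ → ℂ) (L : ℂ), (∀ n, ‖v n‖ = 1) →
      (∀ lam : ℝ, 0 < lam → lam < 1 →
        Tendsto (fun N : ℕ => (N : ℂ)⁻¹ * ∑ n ∈ Finset.range N,
          v n * Complex.exp (-(2 * Real.pi * Complex.I * n * lam))) atTop (𝓝 0)) →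
      Tendsto (fun N : ℕ => (N : ℂ)⁻¹ * ∑ n ∈ Finset.range N, v n) atTop (𝓝 L) →
      Tendsto (fun N : ℕ => (N : ℂ)⁻¹ * ∑ n ∈ Finset.range N, v n * ⟪x, U^[n] x⟫_ℂ) atTop
        (𝓝 (L * p)) := by
  let T : H →L[ℂ] H := (U : H →L[ℂ] H)
  have hTu : T ∈ unitary (H →L[ℂ] H) := by
    rw [Unitary.mem_iff]
    simp only [ContinuousLinearMap.star_eq_adjoint, T, LinearIsometryEquiv.adjoint_eq_symm]
    constructor <;> ext w <;> simp
  have hTn : IsStarNormal T := ⟨by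
    rw [Unitary.mem_iff] at hTu
    rw [Commute, SemiconjBy, hTu.1, hTu.2]⟩
  have hiter : ∀ n : ℕ, ∀ w, (T ^ n) w = U^[n] w := by
    intro n w
    rw [ContinuousLinearMap.coe_pow']
    rfl
  obtain ⟨m, hm, hmom⟩ := spec_measure T hTn x
  have hnorm : ∀ z : spectrum ℂ T, ‖(z : ℂ)‖ = 1 := by
    intro z
    have := spectrum.subset_circle_of_unitary hTu z.2
    simpa using this
  refine ⟨m.real {z | (z : ℂ) = 1}, MeasureTheory.measureReal_nonneg, fun v L hv hl hL => ?_⟩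
  have hmeas : MeasurableSet {z : spectrum ℂ T | (z : ℂ) = 1} :=
    (isClosed_eq continuous_subtype_val continuous_const).measurableSet
  have hlim : L * (m.real {z | (z : ℂ) = 1} : ℂ) =
      ∫ z, Set.indicator {z : spectrum ℂ T | (z : ℂ) = 1} (fun _ => L) z ∂m := by
    rw [MeasureTheory.integral_indicator_const _ hmeas, Complex.real_smul, mul_comm]
  rw [hlim]
  have hcont : ∀ n : ℕ, Continuous (fun z : spectrum ℂ T => v n * (z : ℂ) ^ n) := by
    intro n; fun_prop
  have hsum : ∀ N : ℕ, (N : ℂ)⁻¹ * ∑ n ∈ Finset.range N, v n * ⟪x, U^[n] x⟫_ℂ =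
      ∫ z : spectrum ℂ T, (N : ℂ)⁻¹ * ∑ n ∈ Finset.range N, v n * (z : ℂ) ^ n ∂m := by
    intro N
    rw [MeasureTheory.integral_const_mul, MeasureTheory.integral_finsetSum]
    · congr 1
      refine Finset.sum_congr rfl fun n _ => ?_
      rw [MeasureTheory.integral_const_mul, ← hmom, hiter]
    · intro n _
      exact (hcont n).integrable_of_hasCompactSupport (HasCompactSupport.of_compactSpace _)
  simp only [hsum]
  apply MeasureTheory.tendsto_integral_of_dominated_convergence (fun _ => (1 : ℝ))
  · intro N
    apply Continuous.aestronglyMeasurable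
    fun_prop
  · exact MeasureTheory.integrable_const _
  · intro N
    refine Filter.Eventually.of_forall fun z => ?_
    rw [norm_mul, norm_inv, Complex.norm_natCast]
    have : ‖∑ n ∈ Finset.range N, v n * (z : ℂ) ^ n‖ ≤ N := by
      refine (norm_sum_le _ _).trans ?_
      simp [hv, hnorm z]
    rcases Nat.eq_zero_or_pos N with h | h
    · simp [h]
    · rw [inv_mul_le_iff₀ (by exact_mod_cast h)]
      simpa using this
  · refine Filter.Eventually.of_forall fun z => ?_
    by_cases hz : (z : ℂ) = 1
    · rw [Set.indicator_of_mem (by exact hz)]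
      simpa [hz] using hL
    · rw [Set.indicator_of_notMem (by exact hz)]
      obtain ⟨lam, h0, h1, he⟩ : ∃ lam : ℝ, 0 < lam ∧ lam < 1 ∧
          (z : ℂ) = Complex.exp (-(2 * Real.pi * Complex.I * lam)) := by
        have hpi := Real.pi_pos
        have hza : (z : ℂ) = Complex.exp (Complex.arg z * Complex.I) := by
          have := Complex.norm_mul_exp_arg_mul_I (z : ℂ)
          rw [hnorm z] at this
          simpa using this.symm
        have ha0 : Complex.arg z ≠ 0 := by
          intro h
          rw [h] at hza
          exact hz (by simpa using hza)
        have hlo := Complex.neg_pi_lt_arg (z : ℂ)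
        have hhi := Complex.arg_le_pi (z : ℂ)
        rcases lt_or_gt_of_ne ha0 with h | h
        · refine ⟨-Complex.arg z / (2 * Real.pi), by apply div_pos <;> linarith, ?_, ?_⟩
          · rw [div_lt_one (by positivity)]; linarith
          · conv_lhs => rw [hza]
            congr 1
            have : (Real.pi : ℂ) ≠ 0 := by exact_mod_cast hpi.ne'
            push_cast
            field_simp
        · refine ⟨1 - Complex.arg z / (2 * Real.pi), ?_, ?_, ?_⟩
          · rw [sub_pos, div_lt_one (by positivity)]; linarith
          · have : 0 < Complex.arg z / (2 * Real.pi) := by positivity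
            linarith
          · conv_lhs => rw [hza]
            rw [Complex.exp_eq_exp_iff_exists_int]
            refine ⟨1, ?_⟩
            have : (Real.pi : ℂ) ≠ 0 := by exact_mod_cast hpi.ne'
            push_cast
            field_simp
            ring
      refine (hl lam h0 h1).congr fun N => ?_
      congr 1
      refine Finset.sum_congr rfl fun n _ => ?_
      rw [he, ← Complex.exp_nat_mul]
      congr 2
      ring

theorem avg_one (lam : ℝ) (h0 : 0 < lam) (h1 : lam < 1) :
    Tendsto (fun N : ℕ => (N : ℂ)⁻¹ * ∑ n ∈ Finset.range N,
          (1 : ℂ) * Complex.exp (-(2 * Real.pi * Complex.I * n * lam))) atTop (𝓝 0) := by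
  set z := Complex.exp (-(2 * Real.pi * Complex.I * lam)) with hz
  have hpi : (Real.pi : ℂ) ≠ 0 := by exact_mod_cast Real.pi_pos.ne'
  have hz1 : z ≠ 1 := by
    intro h
    rw [hz, Complex.exp_eq_one_iff] at h
    obtain ⟨k, hk⟩ := h
    have h2 : (lam : ℂ) = ((-k : ℤ) : ℂ) := by
      have hI := Complex.I_ne_zero
      have : (2 * Real.pi * Complex.I) * (lam : ℂ) = (2 * Real.pi * Complex.I) * ((-k : ℤ) : ℂ) := by
        push_cast
        linear_combination -hk
      exact mul_left_cancel₀ (by simp [hpi]) this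
    have h3 : lam = ((-k : ℤ) : ℝ) := by exact_mod_cast h2
    rw [h3] at h0 h1
    have a : (0 : ℤ) < -k := by exact_mod_cast h0
    have b : -k < (1 : ℤ) := by exact_mod_cast h1
    omega
  have hzn : ‖z‖ = 1 := by
    have : z = Complex.exp ((-(2 * Real.pi * lam) : ℝ) * Complex.I) := by
      rw [hz]; congr 1; push_cast; ring
    rw [this, Complex.norm_exp_ofReal_mul_I]
  have hs : ∀ N : ℕ, ∑ n ∈ Finset.range N,
          (1 : ℂ) * Complex.exp (-(2 * Real.pi * Complex.I * n * lam)) = (z ^ N - 1) / (z - 1) := by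
    intro N
    rw [← geom_sum_eq hz1]
    refine Finset.sum_congr rfl fun n _ => ?_
    rw [hz, ← Complex.exp_nat_mul, one_mul]
    congr 1
    ring
  simp only [hs]
  have hlim : Tendsto (fun N : ℕ => (N : ℝ)⁻¹ * (2 / ‖z - 1‖)) atTop (𝓝 0) := by
    simpa using (tendsto_inv_atTop_nhds_zero_nat (𝕜 := ℝ)).mul_const (2 / ‖z - 1‖)
  refine squeeze_zero_norm (fun N => ?_) hlim
  rw [norm_mul, norm_inv, Complex.norm_natCast, norm_div]
  gcongr
  refine (norm_sub_le _ _).trans ?_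
  rw [norm_pow, hzn]
  norm_num

theorem cfun_sub (d : ℕ) (A : ℤ → Matrix (Fin 2) (Fin 2) (ZMod d)) (hA0 : A 0 = 1)
    (hA : Consistent d A) (I J : ℤ →₀ (ZMod d × ZMod d)) :
    cExp d A I J = Bexp d A I J + cExp d A J I := by
  have hdiag : ∀ I J : ℤ →₀ (ZMod d × ZMod d), ∑ a ∈ I.support, (I a).1 * (J a).2 =
      ∑ a ∈ I.support ∪ J.support, (I a).1 * (J a).2 := by
    intro I J
    refine Finset.sum_subset Finset.subset_union_left fun a _ ha => ?_
    simp [Finsupp.notMem_support_iff.mp ha]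
  have hm0 : ∀ M : Matrix (Fin 2) (Fin 2) (ZMod d), mvec M 0 = 0 := by
    intro M; simp [mvec]
  have hs0 : ∀ k : ZMod d × ZMod d, symp k 0 = 0 := by intro k; simp [symp]
  have h0s : ∀ k : ZMod d × ZMod d, symp 0 k = 0 := by intro k; simp [symp]
  have hdbl : ∀ (I J : ℤ →₀ (ZMod d × ZMod d)) (P : ℤ → ℤ → Prop) [∀ a b, Decidable (P a b)],
      ∑ a ∈ I.support, ∑ b ∈ J.support,
        (if P a b then symp (I a) (mvec (A (b - a)) (J b)) else 0) =
      ∑ a ∈ I.support ∪ J.support, ∑ b ∈ I.support ∪ J.support,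
        (if P a b then symp (I a) (mvec (A (b - a)) (J b)) else 0) := by
    intro I J P _
    rw [Finset.sum_subset (Finset.subset_union_left (s₂ := J.support)) fun a _ ha => by
      simp [Finsupp.notMem_support_iff.mp ha, h0s]]
    refine Finset.sum_congr rfl fun a _ => ?_
    refine Finset.sum_subset Finset.subset_union_right fun b _ hb => ?_
    simp [Finsupp.notMem_support_iff.mp hb, h0s, hm0, hs0]
  have hB := hdbl I J (fun _ _ => True)
  simp only [if_true] at hB
  unfold cExp Bexp
  rw [hB, hdiag I J, hdiag J I, hdbl I J (fun a b => b < a), hdbl J I (fun a b => b < a),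
    Finset.union_comm J.support I.support]
  set s := I.support ∪ J.support
  have hsw : ∑ a ∈ s, ∑ b ∈ s, (if b < a then symp (J a) (mvec (A (b - a)) (I b)) else 0) =
      ∑ a ∈ s, ∑ b ∈ s, (if a < b then - symp (I a) (mvec (A (b - a)) (J b)) else 0) := by
    rw [Finset.sum_comm]
    refine Finset.sum_congr rfl fun a _ => Finset.sum_congr rfl fun b _ => ?_
    split_ifs
    · have := hA (b - a) (J b) (I a)
      rw [← this]; congr 3; ring
    · rfl
  have hd2 : ∀ a ∈ s, symp (I a) (J a) =
      ∑ b ∈ s, (if a = b then symp (I a) (mvec (A (b - a)) (J b)) else 0) := by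
    intro a ha
    rw [Finset.sum_ite_eq, if_pos ha, sub_self, hA0]
    simp [mvec]
  have hd3 : ∑ a ∈ s, (I a).1 * (J a).2 = ∑ a ∈ s, (J a).1 * (I a).2 +
      ∑ a ∈ s, ∑ b ∈ s, (if a = b then symp (I a) (mvec (A (b - a)) (J b)) else 0) := by
    rw [← Finset.sum_congr rfl hd2, ← Finset.sum_add_distrib]
    refine Finset.sum_congr rfl fun a _ => ?_
    simp only [symp]; ring
  have hsplit : ∑ a ∈ s, ∑ b ∈ s, symp (I a) (mvec (A (b - a)) (J b)) =
      ∑ a ∈ s, ∑ b ∈ s, (if b < a then symp (I a) (mvec (A (b - a)) (J b)) else 0) +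
      ∑ a ∈ s, ∑ b ∈ s, (if a = b then symp (I a) (mvec (A (b - a)) (J b)) else 0) -
      ∑ a ∈ s, ∑ b ∈ s, (if a < b then - symp (I a) (mvec (A (b - a)) (J b)) else 0) := by
    simp only [← Finset.sum_add_distrib, ← Finset.sum_sub_distrib]
    refine Finset.sum_congr rfl fun a _ => Finset.sum_congr rfl fun b _ => ?_
    rcases lt_trichotomy a b with h | h | h
    · simp [h, h.ne, h.not_gt]
    · simp [h]
    · simp [h, h.ne', h.not_gt]
  rw [hsw, hsplit, hd3]
  ring

theorem exp_char (d : ℕ) [NeZero d] (j : ZMod d) :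
    Complex.exp (2 * Real.pi * Complex.I * (j.val : ℂ) / d) = ZMod.stdAddChar j := by
  have := ZMod.stdAddChar_coe (N := d) (j.val : ℤ)
  push_cast at this
  rw [ZMod.natCast_zmod_val] at this
  exact this.symm

/-- Lemma 3: With `v_n(I) := exp(2πi·u_n(I)/d)`, `u_n(I) := B(I, Sⁿ I)`,
assume that for every `I ≠ 0` the averages `(1/N) Σ_{n<N} v_n(I)·exp(−2πi·n·μ)` converge
to `0` for every `μ ∈ (0,1)`, and converge to some limit `ν₀(I) ≠ 1` for `μ = 0`.  Then the
`U`-invariant vector state is tracial: `⟨Ω, π(I)Ω⟩ = 0` for every `I ≠ 0` and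
`⟨Ω, π(I)π(J)Ω⟩ = ⟨Ω, π(J)π(I)Ω⟩` for all `I, J ∈ G`. -/
theorem stmt12 (d : ℕ) (hd : 2 ≤ d)
    (A : ℤ → Matrix (Fin 2) (Fin 2) (ZMod d)) (hA0 : A 0 = 1) (hA : Consistent d A)
    {H : Type*} [NormedAddCommGroup H] [InnerProductSpace ℂ H] [CompleteSpace H]
    (Ω : H) (hΩ : ‖Ω‖ = 1)
    (pr : (ℤ →₀ (ZMod d × ZMod d)) → (H →L[ℂ] H))
    (hu : ∀ I, pr I ∈ unitary (H →L[ℂ] H))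
    (h1 : pr 0 = 1)
    (hmul : ∀ I J, pr I ∘L pr J = omegaMul d A I J • pr (I + J))
    (U : H ≃ₗᵢ[ℂ] H) (hUΩ : U Ω = Ω)
    (hint : ∀ I x, U (pr I (U.symm x)) = pr (Sg I) x)
    (hspec : ∀ I : ℤ →₀ (ZMod d × ZMod d), I ≠ 0 → ∀ lam : ℝ, 0 < lam → lam < 1 →
      Tendsto (fun N : ℕ => (N : ℂ)⁻¹ * ∑ n ∈ Finset.range N,
          Complex.exp (2 * Real.pi * Complex.I * ((Bexp d A I (Sg^[n] I)).val : ℂ) / d) *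
            Complex.exp (-(2 * Real.pi * Complex.I * n * lam)))
        atTop (𝓝 0))
    (hnu : ∀ I : ℤ →₀ (ZMod d × ZMod d), I ≠ 0 → ∃ L : ℂ, L ≠ 1 ∧
      Tendsto (fun N : ℕ => (N : ℂ)⁻¹ * ∑ n ∈ Finset.range N,
          Complex.exp (2 * Real.pi * Complex.I * ((Bexp d A I (Sg^[n] I)).val : ℂ) / d))
        atTop (𝓝 L)) :
    (∀ I, I ≠ 0 → ⟪Ω, pr I Ω⟫_ℂ = 0) ∧
      ∀ I J, ⟪Ω, pr I (pr J Ω)⟫_ℂ = ⟪Ω, pr J (pr I Ω)⟫_ℂ := by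
  have : NeZero d := ⟨by omega⟩
  simp only [exp_char] at hspec hnu
  have hω : ∀ I J, omegaMul d A I J = ZMod.stdAddChar (cExp d A I J) := fun I J => exp_char d _
  have hcomm : ∀ I J w, pr I (pr J w) = (ZMod.stdAddChar (Bexp d A I J) : ℂ) • pr J (pr I w) := by
    intro I J w
    have e1 : pr I (pr J w) = omegaMul d A I J • pr (I + J) w := congrArg (fun T => T w) (hmul I J)
    have e2 : pr J (pr I w) = omegaMul d A J I • pr (J + I) w := congrArg (fun T => T w) (hmul J I)
    rw [e1, e2, hω, hω, smul_smul, ← AddChar.map_add_eq_mul, ← cfun_sub d A hA0 hA, add_comm J I]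
  have hl : ∀ I w, star (pr I) (pr I w) = w := fun I w =>
    congrArg (fun T : H →L[ℂ] H => T w) (Unitary.mem_iff.mp (hu I)).1
  have hr : ∀ I w, pr I (star (pr I) w) = w := fun I w =>
    congrArg (fun T : H →L[ℂ] H => T w) (Unitary.mem_iff.mp (hu I)).2
  have hUs : U.symm Ω = Ω := by rw [LinearIsometryEquiv.symm_apply_eq, hUΩ]
  have hx : ∀ I (n : ℕ), U^[n] (pr I Ω) = pr (Sg^[n] I) Ω := by
    intro I n
    induction n with
    | zero => rfl
    | succ n ih =>
      rw [Function.iterate_succ_apply', ih, Function.iterate_succ_apply', ← hint, hUs]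
  have hy1 : ∀ I, U (star (pr I) Ω) = star (pr (Sg I)) Ω := by
    intro I
    rw [← hl (Sg I) (U (star (pr I) Ω)), ← hint, LinearIsometryEquiv.symm_apply_apply, hr, hUΩ]
  have hy : ∀ I (n : ℕ), U^[n] (star (pr I) Ω) = star (pr (Sg^[n] I)) Ω := by
    intro I n
    induction n with
    | zero => rfl
    | succ n ih =>
      rw [Function.iterate_succ_apply', ih, Function.iterate_succ_apply', hy1]
  have hchn : ∀ j : ZMod d, ‖(ZMod.stdAddChar j : ℂ)‖ = 1 := by
    intro j
    rw [ZMod.stdAddChar_apply, Circle.norm_coe]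
  have hFG : ∀ I (n : ℕ), (starRingEnd ℂ) ⟪star (pr I) Ω, U^[n] (star (pr I) Ω)⟫_ℂ =
      ZMod.stdAddChar (Bexp d A I (Sg^[n] I)) * ⟪pr I Ω, U^[n] (pr I Ω)⟫_ℂ := by
    intro I n
    rw [hx, hy, inner_conj_symm]
    set J := Sg^[n] I
    have e : pr J (star (pr I) Ω) =
        (ZMod.stdAddChar (Bexp d A I J) : ℂ) • star (pr I) (pr J Ω) := by
      rw [← hl I (pr J (star (pr I) Ω)), hcomm, hr, map_smul]
    rw [ContinuousLinearMap.star_eq_adjoint (pr J), ContinuousLinearMap.adjoint_inner_left, e,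
      inner_smul_right, ContinuousLinearMap.star_eq_adjoint,
      ContinuousLinearMap.adjoint_inner_right]
  have hGF : ∀ I (n : ℕ), (starRingEnd ℂ) ⟪pr I Ω, U^[n] (pr I Ω)⟫_ℂ =
      ZMod.stdAddChar (Bexp d A I (Sg^[n] I)) * ⟪star (pr I) Ω, U^[n] (star (pr I) Ω)⟫_ℂ := by
    intro I n
    have h := congrArg (starRingEnd ℂ) (hFG I n)
    rw [Complex.conj_conj, map_mul] at h
    rw [h, ← mul_assoc, Complex.mul_conj, Complex.normSq_eq_norm_sq, hchn]
    simp
  have hone : Tendsto (fun N : ℕ => (N : ℂ)⁻¹ * ∑ n ∈ Finset.range N, (1 : ℂ)) atTop (𝓝 1) := by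
    refine tendsto_const_nhds.congr' ?_
    filter_upwards [eventually_gt_atTop 0] with N hN
    have : (N : ℂ) ≠ 0 := by exact_mod_cast hN.ne'
    simp [this]
  have main : ∀ I, I ≠ 0 → ⟪Ω, pr I Ω⟫_ℂ = 0 := by
    intro I hI
    obtain ⟨L, hL1, hL⟩ := hnu I hI
    set x := pr I Ω with hxdef
    set y := star (pr I) Ω with hydef
    obtain ⟨p, hp0, hp⟩ := avg_spec U x
    obtain ⟨q, hq0, hq⟩ := avg_spec U y
    have hp1 := hp (fun _ => 1) 1 (by simp) avg_one hone
    have hq1 := hq (fun _ => 1) 1 (by simp) avg_one hone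
    have hpv := hp _ L (fun n => hchn _) (hspec I hI) hL
    have hqv := hq _ L (fun n => hchn _) (hspec I hI) hL
    have conjavg : ∀ (F : ℕ → ℂ) (l : ℝ), Tendsto (fun N : ℕ => (N : ℂ)⁻¹ *
        ∑ n ∈ Finset.range N, 1 * F n) atTop (𝓝 (1 * (l : ℂ))) →
        Tendsto (fun N : ℕ => (N : ℂ)⁻¹ *
        ∑ n ∈ Finset.range N, (starRingEnd ℂ) (F n)) atTop (𝓝 (l : ℂ)) := by
      intro F l h
      have h2 := (Complex.continuous_conj.tendsto _).comp h
      simpa [Function.comp_def] using h2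
    have hpc := conjavg _ _ hp1
    have hqc := conjavg _ _ hq1
    have E1 : L * p = q := by
      refine tendsto_nhds_unique hpv (hqc.congr fun N => ?_)
      congr 1
      exact Finset.sum_congr rfl fun n _ => hFG I n
    have E2 : L * q = p := by
      refine tendsto_nhds_unique hqv (hpc.congr fun N => ?_)
      congr 1
      exact Finset.sum_congr rfl fun n _ => hGF I n
    have hpq : ((p + q : ℝ) : ℂ) = 0 := by
      have : (1 - L) * ((p + q : ℝ) : ℂ) = 0 := by
        push_cast
        linear_combination -E1 - E2
      exact (mul_eq_zero.mp this).resolve_left (sub_ne_zero.mpr hL1.symm)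
    have hpq' : p + q = 0 := by exact_mod_cast hpq
    have hpz : p = 0 := by linarith
    -- decompose x
    set c := ⟪Ω, x⟫_ℂ with hc
    set w := x - c • Ω with hw
    have hΩw : ⟪Ω, w⟫_ℂ = 0 := by
      rw [hw, inner_sub_right, inner_smul_right, inner_self_eq_norm_sq_to_K, hΩ]
      simp [hc]
    have hit : ∀ n : ℕ, U^[n] x = c • Ω + U^[n] w ∧ ⟪Ω, U^[n] w⟫_ℂ = 0 := by
      intro n
      induction n with
      | zero => exact ⟨by simp [hw], hΩw⟩
      | succ n ih =>
        simp only [Function.iterate_succ_apply']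
        refine ⟨by rw [ih.1, map_add, map_smul, hUΩ], ?_⟩
        conv_lhs => rw [← hUΩ]
        rw [LinearIsometryEquiv.inner_map_map, ih.2]
    obtain ⟨r, hr0, hrr⟩ := avg_spec U w
    have hr1 := hrr (fun _ => 1) 1 (by simp) avg_one hone
    have hterm : ∀ n : ℕ, ⟪x, U^[n] x⟫_ℂ = ((‖c‖ ^ 2 : ℝ) : ℂ) + ⟪w, U^[n] w⟫_ℂ := by
      intro n
      have hxw : x = c • Ω + w := by simp [hw]
      have hwΩ : ⟪w, Ω⟫_ℂ = 0 := by rw [← inner_conj_symm, hΩw, map_zero]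
      rw [(hit n).1]
      conv_lhs => rw [hxw]
      rw [inner_add_left, inner_add_right, inner_add_right, inner_smul_left, inner_smul_left,
        inner_smul_right, inner_smul_right, (hit n).2, hwΩ, inner_self_eq_norm_sq_to_K, hΩ]
      have := Complex.conj_mul' c
      simp [this]
    have E3 : (1 : ℂ) * p = 1 * ((‖c‖ ^ 2 : ℝ) : ℂ) + 1 * r := by
      refine tendsto_nhds_unique hp1 (((hone.mul_const ((‖c‖ ^ 2 : ℝ) : ℂ)).add hr1).congr
        fun N => ?_)
      simp only [hterm, one_mul, Finset.sum_add_distrib, Finset.sum_const, nsmul_eq_mul, mul_one]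
      ring
    have E4 : p = ‖c‖ ^ 2 + r := by
      simp only [one_mul] at E3
      exact_mod_cast E3
    have : ‖c‖ ^ 2 = 0 := by nlinarith [sq_nonneg ‖c‖]
    simpa using this
  refine ⟨main, fun I J => ?_⟩
  by_cases hIJ : I + J = 0
  · have hJ : pr I ∘L pr J = omegaMul d A I J • (1 : H →L[ℂ] H) := by rw [hmul, hIJ, h1]
    have e : ∀ w, pr I (pr J w) = omegaMul d A I J • w := fun w => congrArg (fun T => T w) hJ
    have e2 : pr J (pr I Ω) = omegaMul d A I J • Ω := by
      rw [← hl I (pr J (pr I Ω)), e, map_smul, hl]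
    rw [e, e2]
  · have e1 : pr I (pr J Ω) = omegaMul d A I J • pr (I + J) Ω :=
      congrArg (fun T => T Ω) (hmul I J)
    have e2 : pr J (pr I Ω) = omegaMul d A J I • pr (J + I) Ω :=
      congrArg (fun T => T Ω) (hmul J I)
    rw [e1, e2, add_comm J I, inner_smul_right, inner_smul_right, main _ hIJ, mul_zero, mul_zero]
end
end
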